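/- Let a < b be real numbers and let γ : [0,1] → (a,b)ⁿ be a strictly monotonic continuously differentiable path. Let j₁, …, jᵣ be distinct indices in {1,…,n} such that γ_{j₁}(0) = ⋯ = γ_{jᵣ}(0) and γ_{j₁}(1) = ⋯ = γ_{jᵣ}(1), and suppose that for each pair of indices jₖ ≠ jₗ among them, γ is IG-symmetry preserving for variables x_{jₖ} and x_{jₗ}. Then γ_{j₁}(t) = ⋯ = γ_{jᵣ}(t) for all t ∈ [0,1]; in particular the image of the map t ↦ (γ_{j₁}(t), …, γ_{jᵣ}(t)) is contained in the diagonal line {(s,…,s) : s ∈ ℝ} of ℝʳ, so it traces a straight line in ℝʳ. -/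

import Mathlib

open Set MeasureTheory

/-- A continuously differentiable path `γ : [0,1] → (a,b)ⁿ` is *IG-symmetry preserving*
for the variables `xᵢ` and `xⱼ` if, whenever `γᵢ(0) = γⱼ(0)` and `γᵢ(1) = γⱼ(1)`, every
Lipschitz continuous `F : (a,b)ⁿ → ℝ` which is symmetric in `xᵢ, xⱼ` and differentiable
at `γ t` for a.e. `t ∈ [0,1]` satisfies
`∫₀¹ (∂F/∂xᵢ)(γ(t)) γᵢ'(t) dt = ∫₀¹ (∂F/∂xⱼ)(γ(t)) γⱼ'(t) dt`. -/
def IGSymmetryPreserving {n : ℕ} (a b : ℝ) (γ : ℝ → EuclideanSpace ℝ (Fin n))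
    (i j : Fin n) : Prop :=
  γ 0 i = γ 0 j → γ 1 i = γ 1 j →
    ∀ F : EuclideanSpace ℝ (Fin n) → ℝ,
      (∃ K : NNReal, LipschitzOnWith K F {x : EuclideanSpace ℝ (Fin n) | ∀ k, x k ∈ Ioo a b}) →
      (∀ x : EuclideanSpace ℝ (Fin n), (∀ k, x k ∈ Ioo a b) →
        F (WithLp.toLp 2 (fun k => x (Equiv.swap i j k))) = F x) →
      (∀ᵐ t ∂(volume.restrict (Icc (0:ℝ) 1)), DifferentiableAt ℝ F (γ t)) →
      ∫ t in (0:ℝ)..1,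
          fderiv ℝ F (γ t) (EuclideanSpace.single i 1) * derivWithin (fun s => γ s i) (Icc (0:ℝ) 1) t
        = ∫ t in (0:ℝ)..1,
          fderiv ℝ F (γ t) (EuclideanSpace.single j 1) * derivWithin (fun s => γ s j) (Icc (0:ℝ) 1) t

/-- A primitive of the continuous function `x ↦ max 0 ((x - p) * (q - x))`. -/
noncomputable def bumpPrimitive (p q x : ℝ) : ℝ :=
  ∫ s in p..x, max 0 ((s - p) * (q - s))

lemma hasDerivAt_bumpPrimitive (p q x : ℝ) :
    HasDerivAt (bumpPrimitive p q) (max 0 ((x - p) * (q - x))) x := by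
  have hc : Continuous fun s : ℝ => max 0 ((s - p) * (q - s)) := by fun_prop
  exact intervalIntegral.integral_hasDerivAt_right (hc.intervalIntegrable _ _)
    hc.stronglyMeasurable.stronglyMeasurableAtFilter hc.continuousAt

lemma strictMonoOn_bumpPrimitive (p q : ℝ) : StrictMonoOn (bumpPrimitive p q) (Icc p q) := by
  refine strictMonoOn_of_deriv_pos (convex_Icc p q)
    (fun x _ => (hasDerivAt_bumpPrimitive p q x).continuousAt.continuousWithinAt) fun x hx => ?_
  rw [interior_Icc] at hx
  rw [(hasDerivAt_bumpPrimitive p q x).deriv]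
  exact lt_max_of_lt_right (mul_pos (sub_pos.2 hx.1) (sub_pos.2 hx.2))

/-- Two continuous functions agreeing at the endpoints of `[0,1]` and ordered at `t₀` are strictly
ordered on an open interval around `t₀` at whose endpoints they agree. -/
lemma exists_excursion_interval {u v : ℝ → ℝ} (hu : ContinuousOn u (Icc 0 1))
    (hv : ContinuousOn v (Icc 0 1)) (h0 : u 0 = v 0) (h1 : u 1 = v 1) {t₀ : ℝ}
    (ht₀ : t₀ ∈ Icc (0 : ℝ) 1) (hlt : u t₀ < v t₀) :
    ∃ c d, 0 ≤ c ∧ c < d ∧ d ≤ 1 ∧ u c = v c ∧ u d = v d ∧ ∀ t ∈ Ioo c d, u t < v t := by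
  have hw : ContinuousOn (fun t => v t - u t) (Icc 0 1) := hv.sub hu
  have hwL := hw.mono (Icc_subset_Icc_right ht₀.2)
  have hwR := hw.mono (Icc_subset_Icc_left ht₀.1)
  obtain ⟨c, ⟨hcI, hc⟩, hcmax⟩ := (isCompact_Icc.of_isClosed_subset
    (hwL.preimage_isClosed_of_isClosed isClosed_Icc isClosed_Iic)
    inter_subset_left).exists_isGreatest
    (s := Icc 0 t₀ ∩ (fun t => v t - u t) ⁻¹' Iic 0) ⟨0, ⟨le_rfl, ht₀.1⟩, by simp [h0]⟩
  obtain ⟨d, ⟨hdI, hd⟩, hdmin⟩ := (isCompact_Icc.of_isClosed_subset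
    (hwR.preimage_isClosed_of_isClosed isClosed_Icc isClosed_Iic)
    inter_subset_left).exists_isLeast
    (s := Icc t₀ 1 ∩ (fun t => v t - u t) ⁻¹' Iic 0) ⟨1, ⟨ht₀.2, le_rfl⟩, by simp [h1]⟩
  simp only [mem_preimage, mem_Iic] at hc hd
  have hct : c < t₀ := hcI.2.lt_of_ne (by rintro rfl; linarith)
  have htd : t₀ < d := hdI.1.lt_of_ne (by rintro rfl; linarith)
  refine ⟨c, d, hcI.1, hct.trans htd, hdI.2, ?_, ?_, fun t ht => ?_⟩
  · obtain ⟨s, hs, hs0⟩ := intermediate_value_Icc hct.le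
      (hwL.mono (Icc_subset_Icc_left hcI.1)) ⟨hc, by linarith⟩
    have : s ≤ c := hcmax ⟨⟨hcI.1.trans hs.1, hs.2⟩, hs0.le⟩
    obtain rfl := le_antisymm this hs.1
    simp only at hs0
    linarith
  · obtain ⟨s, hs, hs0⟩ := intermediate_value_Icc' htd.le
      (hwR.mono (Icc_subset_Icc_right hdI.2)) ⟨hd, by linarith⟩
    have : d ≤ s := hdmin ⟨⟨hs.1, hs.2.trans hdI.2⟩, hs0.le⟩
    obtain rfl := le_antisymm hs.2 this
    simp only at hs0
    linarith
  · by_contra! h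
    have h' : v t - u t ≤ 0 := by linarith
    rcases le_total t t₀ with htt | htt
    · exact (hcmax ⟨⟨hcI.1.trans ht.1.le, htt⟩, h'⟩).not_gt ht.1
    · exact (hdmin ⟨⟨htt, ht.2.le.trans hdI.2⟩, h'⟩).not_gt ht.2

/-- The product test functions `(x, y) ↦ Φ x * Φ y` detect the ordering of two increasing
functions with the same endpoint values. -/
lemma not_lt_of_product_test {u v : ℝ → ℝ} (hu : ContDiffOn ℝ 1 u (Icc 0 1))
    (hv : ContDiffOn ℝ 1 v (Icc 0 1)) (hum : StrictMonoOn u (Icc 0 1))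
    (hvm : StrictMonoOn v (Icc 0 1)) (h0 : u 0 = v 0) (h1 : u 1 = v 1)
    (H : ∀ Φ m : ℝ → ℝ, Continuous m → (∀ x, HasDerivAt Φ (m x) x) →
      ∫ t in (0 : ℝ)..1, m (u t) * Φ (v t) * derivWithin u (Icc 0 1) t =
        ∫ t in (0 : ℝ)..1, Φ (u t) * m (v t) * derivWithin v (Icc 0 1) t)
    {t₀ : ℝ} (ht₀ : t₀ ∈ Icc (0 : ℝ) 1) : ¬ u t₀ < v t₀ := by
  intro hlt
  obtain ⟨c, d, hc0, hcd, hd1, huc, hud, huv⟩ :=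
    exists_excursion_interval hu.continuousOn hv.continuousOn h0 h1 ht₀ hlt
  have hsub : Icc c d ⊆ Icc (0 : ℝ) 1 := Icc_subset_Icc hc0 hd1
  have hcm : c ∈ Icc (0 : ℝ) 1 := hsub (left_mem_Icc.2 hcd.le)
  have hdm : d ∈ Icc (0 : ℝ) 1 := hsub (right_mem_Icc.2 hcd.le)
  set u' := derivWithin u (Icc 0 1)
  set v' := derivWithin v (Icc 0 1)
  have hu'c : ContinuousOn u' (Icc 0 1) :=
    hu.continuousOn_derivWithin (uniqueDiffOn_Icc zero_lt_one) le_rfl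
  have hv'c : ContinuousOn v' (Icc 0 1) :=
    hv.continuousOn_derivWithin (uniqueDiffOn_Icc zero_lt_one) le_rfl
  have hud' : ∀ t ∈ Ioo c d, HasDerivAt u (u' t) t := fun t ht =>
    (hu.differentiableOn one_ne_zero t (hsub (Ioo_subset_Icc_self ht))).hasDerivWithinAt.hasDerivAt
      (Icc_mem_nhds (hc0.trans_lt ht.1) (ht.2.trans_le hd1))
  have hvd' : ∀ t ∈ Ioo c d, HasDerivAt v (v' t) t := fun t ht =>
    (hv.differentiableOn one_ne_zero t (hsub (Ioo_subset_Icc_self ht))).hasDerivWithinAt.hasDerivAt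
      (Icc_mem_nhds (hc0.trans_lt ht.1) (ht.2.trans_le hd1))
  set p := u c
  set q := u d with hq
  set Φ := bumpPrimitive p q
  set m : ℝ → ℝ := fun x => max 0 ((x - p) * (q - x))
  have hmc : Continuous m := by fun_prop
  have hΦ : ∀ x, HasDerivAt Φ (m x) x := hasDerivAt_bumpPrimitive p q
  have hΦc : Continuous Φ := continuous_iff_continuousAt.2 fun x => (hΦ x).continuousAt
  have hpq : p < q := hum hcm hdm hcd
  have hm0 : ∀ x, x ≤ p ∨ q ≤ x → m x = 0 := by
    intro x hx
    apply max_eq_left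
    rcases hx with hx | hx <;> nlinarith
  have hucont := hu.continuousOn
  have hvcont := hv.continuousOn
  have hUc : ContinuousOn (fun t => Φ (u t)) (Icc 0 1) := hΦc.comp_continuousOn hucont
  have hVc : ContinuousOn (fun t => Φ (v t)) (Icc 0 1) := hΦc.comp_continuousOn hvcont
  have hmuc : ContinuousOn (fun t => m (u t)) (Icc 0 1) := hmc.comp_continuousOn hucont
  have hmvc : ContinuousOn (fun t => m (v t)) (Icc 0 1) := hmc.comp_continuousOn hvcont
  have hA : ContinuousOn (fun t => m (u t) * Φ (v t) * u' t) (Icc 0 1) := (hmuc.mul hVc).mul hu'c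
  have hB : ContinuousOn (fun t => Φ (u t) * m (v t) * v' t) (Icc 0 1) := (hUc.mul hmvc).mul hv'c
  have restrict : ∀ f : ℝ → ℝ, (∀ t ∈ Icc (0 : ℝ) 1, t ∉ Ioo c d → f t = 0) →
      ∫ t in (0 : ℝ)..1, f t = ∫ t in c..d, f t := by
    intro f hf
    rw [intervalIntegral.integral_of_le zero_le_one, intervalIntegral.integral_of_le hcd.le]
    refine (setIntegral_eq_of_subset_of_forall_sdiff_eq_zero measurableSet_Ioc
      (Ioc_subset_Ioc hc0 hd1) fun t ht => ?_)
    exact hf t (Ioc_subset_Icc_self ht.1) fun h => ht.2 (Ioo_subset_Ioc_self h)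
  have hout : ∀ t ∈ Icc (0 : ℝ) 1, t ∉ Ioo c d → m (u t) = 0 ∧ m (v t) = 0 := by
    intro t ht hn
    rcases le_or_gt t c with h | h
    · exact ⟨hm0 _ (.inl (hum.monotoneOn ht hcm h)),
        hm0 _ (.inl (huc ▸ hvm.monotoneOn ht hcm h))⟩
    · have h' : d ≤ t := not_lt.1 fun h' => hn ⟨h, h'⟩
      exact ⟨hm0 _ (.inr (hum.monotoneOn hdm ht h')),
        hm0 _ (.inr (hud ▸ hvm.monotoneOn hdm ht h'))⟩
  have key := H Φ m hmc hΦ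
  rw [restrict _ fun t ht hn => by simp [(hout t ht hn).1],
    restrict _ fun t ht hn => by simp [(hout t ht hn).2]] at key
  have hC : ContinuousOn (fun t => Φ (u t) * (m (u t) * u' t)) (Icc 0 1) :=
    hUc.mul (hmuc.mul hu'c)
  have integrable : ∀ f : ℝ → ℝ, ContinuousOn f (Icc 0 1) →
      IntervalIntegrable f volume c d := fun f hf =>
    (hf.mono hsub).intervalIntegrable_of_Icc hcd.le
  have ibp : ∫ t in c..d, (Φ (u t) * m (v t) * v' t + m (u t) * Φ (v t) * u' t -
      2 * (Φ (u t) * (m (u t) * u' t))) = 0 := by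
    have := intervalIntegral.integral_eq_sub_of_hasDerivAt_of_le hcd.le
      (f := fun t => Φ (u t) * Φ (v t) - Φ (u t) * Φ (u t))
      (f' := fun t => Φ (u t) * m (v t) * v' t + m (u t) * Φ (v t) * u' t -
        2 * (Φ (u t) * (m (u t) * u' t)))
      (((hUc.mul hVc).sub (hUc.mul hUc)).mono hsub)
      (fun t ht => by
        have hU : HasDerivAt (fun t => Φ (u t)) (m (u t) * u' t) t := (hΦ _).comp t (hud' t ht)
        have hV : HasDerivAt (fun t => Φ (v t)) (m (v t) * v' t) t := (hΦ _).comp t (hvd' t ht)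
        exact ((hU.mul hV).sub (hU.mul hU)).congr_deriv (by ring))
      (integrable _ ((hB.add hA).sub (continuousOn_const.mul hC)))
    rw [this, ← huc, ← hud]
    ring
  have hzero : ∫ t in c..d, (Φ (v t) - Φ (u t)) * (m (u t) * u' t) = 0 := by
    rw [intervalIntegral.integral_sub
        (integrable (fun t => Φ (u t) * m (v t) * v' t + m (u t) * Φ (v t) * u' t) (hB.add hA))
        (integrable (fun t => 2 * (Φ (u t) * (m (u t) * u' t))) (continuousOn_const.mul hC)),
      intervalIntegral.integral_add (integrable _ hB) (integrable _ hA),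
      intervalIntegral.integral_const_mul] at ibp
    have hsplit : ∫ t in c..d, (Φ (v t) - Φ (u t)) * (m (u t) * u' t) =
        (∫ t in c..d, m (u t) * Φ (v t) * u' t) - ∫ t in c..d, Φ (u t) * (m (u t) * u' t) := by
      rw [← intervalIntegral.integral_sub (integrable _ hA) (integrable _ hC)]
      congr 1
      ext t
      ring
    linarith
  have hvalue : ∀ t ∈ Ioo c d, u t ∈ Ioo p q ∧ v t ∈ Icc p q := fun t ht => by
    have htm := hsub (Ioo_subset_Icc_self ht)
    exact ⟨⟨hum hcm htm ht.1, hum htm hdm ht.2⟩,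
      huc ▸ hvm.monotoneOn hcm htm ht.1.le, hud ▸ hvm.monotoneOn htm hdm ht.2.le⟩
  have hΦlt : ∀ t ∈ Ioo c d, 0 < Φ (v t) - Φ (u t) := fun t ht =>
    sub_pos.2 (strictMonoOn_bumpPrimitive p q (Ioo_subset_Icc_self (hvalue t ht).1)
      (hvalue t ht).2 (huv t ht))
  have hu'0 : ∀ t, 0 ≤ u' t := fun t => hum.monotoneOn.derivWithin_nonneg
  obtain ⟨ξ, hξ, hξd⟩ := exists_hasDerivAt_eq_slope u u' hcd (hucont.mono hsub) hud'
  have hξpos : 0 < u' ξ := hξd ▸ div_pos (sub_pos.2 hpq) (sub_pos.2 hcd)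
  refine (intervalIntegral.integral_pos hcd
    (((hVc.sub hUc).mul (hmuc.mul hu'c)).mono hsub) (fun t ht => ?_)
    ⟨ξ, Ioo_subset_Icc_self hξ, ?_⟩).ne' hzero
  · rcases ht.2.lt_or_eq with h | rfl
    · exact mul_nonneg (hΦlt t ⟨ht.1, h⟩).le (mul_nonneg (le_max_left _ _) (hu'0 t))
    · simp [← hud, ← hq]
  · exact mul_pos (hΦlt ξ hξ) (mul_pos (lt_max_of_lt_right
      (mul_pos (sub_pos.2 (hvalue ξ hξ).1.1) (sub_pos.2 (hvalue ξ hξ).1.2))) hξpos)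

lemma eqOn_of_product_test_of_strictMonoOn {u v : ℝ → ℝ} (hu : ContDiffOn ℝ 1 u (Icc 0 1))
    (hv : ContDiffOn ℝ 1 v (Icc 0 1)) (hum : StrictMonoOn u (Icc 0 1))
    (hvm : StrictMonoOn v (Icc 0 1)) (h0 : u 0 = v 0) (h1 : u 1 = v 1)
    (H : ∀ Φ m : ℝ → ℝ, Continuous m → (∀ x, HasDerivAt Φ (m x) x) →
      ∫ t in (0 : ℝ)..1, m (u t) * Φ (v t) * derivWithin u (Icc 0 1) t =
        ∫ t in (0 : ℝ)..1, Φ (u t) * m (v t) * derivWithin v (Icc 0 1) t) :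
    EqOn u v (Icc 0 1) := fun t ht => by
  refine le_antisymm (not_lt.1 ?_) (not_lt.1 (not_lt_of_product_test hu hv hum hvm h0 h1 H ht))
  refine not_lt_of_product_test hv hu hvm hum h0.symm h1.symm (fun Φ m hm hΦ => ?_) ht
  simpa only [mul_comm (m _) (Φ _)] using (H Φ m hm hΦ).symm

lemma eqOn_of_product_test {u v : ℝ → ℝ} (hu : ContDiffOn ℝ 1 u (Icc 0 1))
    (hv : ContDiffOn ℝ 1 v (Icc 0 1))
    (hum : StrictMonoOn u (Icc 0 1) ∨ StrictAntiOn u (Icc 0 1))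
    (hvm : StrictMonoOn v (Icc 0 1) ∨ StrictAntiOn v (Icc 0 1)) (h0 : u 0 = v 0) (h1 : u 1 = v 1)
    (H : ∀ Φ m : ℝ → ℝ, Continuous m → (∀ x, HasDerivAt Φ (m x) x) →
      ∫ t in (0 : ℝ)..1, m (u t) * Φ (v t) * derivWithin u (Icc 0 1) t =
        ∫ t in (0 : ℝ)..1, Φ (u t) * m (v t) * derivWithin v (Icc 0 1) t) :
    EqOn u v (Icc 0 1) := by
  have m0 : (0 : ℝ) ∈ Icc (0 : ℝ) 1 := by simp
  have m1 : (1 : ℝ) ∈ Icc (0 : ℝ) 1 := by simp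
  rcases hum with hum | hum <;> rcases hvm with hvm | hvm
  · exact eqOn_of_product_test_of_strictMonoOn hu hv hum hvm h0 h1 H
  · linarith [hum m0 m1 zero_lt_one, hvm m0 m1 zero_lt_one]
  · linarith [hum m0 m1 zero_lt_one, hvm m0 m1 zero_lt_one]
  · have hneg := eqOn_of_product_test_of_strictMonoOn hu.neg hv.neg hum.neg hvm.neg
      (by simp [h0]) (by simp [h1]) fun Φ m hm hΦ => ?_
    · exact fun t ht => neg_injective (hneg ht)
    have h := H (fun x => Φ (-x)) (fun x => -m (-x)) (by fun_prop) fun x =>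
      ((hΦ (-x)).comp x (hasDerivAt_neg x)).congr_deriv (by ring)
    simpa [derivWithin.fun_neg, derivWithin.neg] using h

/-- Symmetry preservation, tested on the function `x ↦ Φ (x i) * Φ (x j)`. -/
lemma IGSymmetryPreserving.integral_product_eq {n : ℕ} {a b : ℝ}
    {γ : ℝ → EuclideanSpace ℝ (Fin n)} {i j : Fin n} (hij : i ≠ j)
    (h : IGSymmetryPreserving a b γ i j) (h0 : γ 0 i = γ 0 j) (h1 : γ 1 i = γ 1 j)
    {Φ m : ℝ → ℝ} (hm : Continuous m) (hΦ : ∀ x, HasDerivAt Φ (m x) x) :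
    ∫ t in (0 : ℝ)..1, m (γ t i) * Φ (γ t j) * derivWithin (fun s => γ s i) (Icc 0 1) t =
      ∫ t in (0 : ℝ)..1, Φ (γ t i) * m (γ t j) * derivWithin (fun s => γ s j) (Icc 0 1) t := by
  have hcoord : ∀ (k : Fin n) (x : EuclideanSpace ℝ (Fin n)),
      HasFDerivAt (fun x : EuclideanSpace ℝ (Fin n) => x k)
        (EuclideanSpace.proj k : EuclideanSpace ℝ (Fin n) →L[ℝ] ℝ) x :=
    fun k x => (EuclideanSpace.proj k : EuclideanSpace ℝ (Fin n) →L[ℝ] ℝ).hasFDerivAt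
  have hF := fun x : EuclideanSpace ℝ (Fin n) =>
    ((hΦ (x i)).comp_hasFDerivAt x (hcoord i x)).mul
      ((hΦ (x j)).comp_hasFDerivAt x (hcoord j x))
  have hΦ1 : ContDiff ℝ 1 Φ := contDiff_one_iff_deriv.2
    ⟨fun x => (hΦ x).differentiableAt, by rwa [funext fun x => (hΦ x).deriv]⟩
  have hcoord1 : ∀ k : Fin n, ContDiff ℝ 1 (fun x : EuclideanSpace ℝ (Fin n) => x k) :=
    fun k => (EuclideanSpace.proj k : EuclideanSpace ℝ (Fin n) →L[ℝ] ℝ).contDiff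
  have hF1 : ContDiff ℝ 1 (fun x : EuclideanSpace ℝ (Fin n) => Φ (x i) * Φ (x j)) :=
    (hΦ1.comp (hcoord1 i)).mul (hΦ1.comp (hcoord1 j))
  have hLip : ∃ K : NNReal, LipschitzOnWith K
      (fun x : EuclideanSpace ℝ (Fin n) => Φ (x i) * Φ (x j)) {x | ∀ k, x k ∈ Ioo a b} := by
    have hcpt : IsCompact {x : EuclideanSpace ℝ (Fin n) | ∀ k, x k ∈ Icc a b} := by
      have := (isCompact_univ_pi fun _ : Fin n => isCompact_Icc (a := a) (b := b)).image
        (PiLp.continuous_toLp 2 fun _ : Fin n => ℝ)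
      convert this using 1
      ext x
      constructor
      · exact fun hx => ⟨x.ofLp, fun k _ => hx k, rfl⟩
      · rintro ⟨y, hy, rfl⟩ k
        exact hy k trivial
    have hconv : Convex ℝ {x : EuclideanSpace ℝ (Fin n) | ∀ k, x k ∈ Icc a b} :=
      fun x hx y hy s t hs ht hst k => convex_Icc a b (hx k) (hy k) hs ht hst
    obtain ⟨K, hK⟩ := hF1.contDiffOn.exists_lipschitzOnWith one_ne_zero hconv hcpt
    exact ⟨K, hK.mono fun x hx k => Ioo_subset_Icc_self (hx k)⟩
  have key := h h0 h1 (fun x => Φ (x i) * Φ (x j)) hLip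
    (fun x _ => by simp [mul_comm]) (.of_forall fun t => (hF (γ t)).differentiableAt)
  have hfd : ∀ x : EuclideanSpace ℝ (Fin n),
      fderiv ℝ (fun x : EuclideanSpace ℝ (Fin n) => Φ (x i) * Φ (x j)) x = _ :=
    fun x => (hF x).fderiv
  simpa [hfd, hij, hij.symm, mul_comm (m _) (Φ _)] using key

/-- If a strictly monotonic continuously differentiable path `γ : [0,1] → (a,b)ⁿ` has
components `γ_{j₁}, …, γ_{jᵣ}` (for distinct indices `j₁, …, jᵣ`) agreeing at `t = 0`
and at `t = 1`, and `γ` is IG-symmetry preserving for each pair of these variables, then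
`γ_{j₁}(t) = ⋯ = γ_{jᵣ}(t)` for all `t ∈ [0,1]`: the curve `t ↦ (γ_{j₁}(t), …, γ_{jᵣ}(t))`
stays on the diagonal line of `ℝʳ`, hence traces a straight line. -/
theorem igSymmetryPreserving_pairs_diagonal {n r : ℕ} (a b : ℝ) (hab : a < b)
    (γ : ℝ → EuclideanSpace ℝ (Fin n))
    (hγbox : ∀ t ∈ Icc (0:ℝ) 1, ∀ k, γ t k ∈ Ioo a b)
    (hγ : ContDiffOn ℝ 1 γ (Icc (0:ℝ) 1))
    (hmono : ∀ k : Fin n, StrictMonoOn (fun t => γ t k) (Icc (0:ℝ) 1) ∨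
      StrictAntiOn (fun t => γ t k) (Icc (0:ℝ) 1))
    (e : Fin r → Fin n) (he : Function.Injective e)
    (h0 : ∀ k l : Fin r, γ 0 (e k) = γ 0 (e l))
    (h1 : ∀ k l : Fin r, γ 1 (e k) = γ 1 (e l))
    (hsym : ∀ k l : Fin r, k ≠ l → IGSymmetryPreserving a b γ (e k) (e l)) :
    (∀ t ∈ Icc (0:ℝ) 1, ∀ k l : Fin r, γ t (e k) = γ t (e l)) ∧
    (∀ t ∈ Icc (0:ℝ) 1, (fun k : Fin r => γ t (e k)) ∈
      {y : Fin r → ℝ | ∃ s : ℝ, y = fun _ => s}) := by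
  have hcoord : ∀ i : Fin n, ContDiffOn ℝ 1 (fun t => γ t i) (Icc 0 1) := fun i =>
    (EuclideanSpace.proj i : EuclideanSpace ℝ (Fin n) →L[ℝ] ℝ).contDiff.comp_contDiffOn hγ
  have hdiag : ∀ t ∈ Icc (0:ℝ) 1, ∀ k l : Fin r, γ t (e k) = γ t (e l) := by
    intro t ht k l
    rcases eq_or_ne k l with rfl | hkl
    · rfl
    · exact eqOn_of_product_test (hcoord (e k)) (hcoord (e l)) (hmono _) (hmono _) (h0 k l)
        (h1 k l) (fun Φ m hm hΦ => (hsym k l hkl).integral_product_eq (he.ne hkl) (h0 k l)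
          (h1 k l) hm hΦ) ht
  refine ⟨hdiag, fun t ht => ?_⟩
  rcases isEmpty_or_nonempty (Fin r) with hr | ⟨⟨k⟩⟩
  · exact ⟨0, Subsingleton.elim _ _⟩
  · exact ⟨γ t (e k), funext fun l => hdiag t ht l k⟩
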